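/- Let 𝓛 be a codimension-one affine subspace of ℝⁿ parametrized by x ↦ (x, (1,x)A) where A ∈ M_{n,1}(ℝ) is a column vector. Then ω(𝓛) = max(ω(A), n), where ω(𝓛) is the Diophantine exponent of 𝓛 (the essential supremum of ω(y) over y ∈ 𝓛 with respect to Lebesgue measure on 𝓛) and ω(A) is the Diophantine exponent of the column vector A. -/

import Mathlib

open Finset Real ENNReal MeasureTheory

/-- Sup norm of an integer vector. -/
def snormZ {n : ℕ} (q : Fin n → ℤ) : ℝ :=
  ((Finset.univ.sup fun i => (q i).natAbs : ℕ) : ℝ)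

/-- The Diophantine exponent `ω(y)` of a row vector `y ∈ ℝⁿ`. -/
noncomputable def omegaExp {n : ℕ} (y : Fin n → ℝ) : ℝ≥0∞ :=
  sSup {e : ℝ≥0∞ | ∃ v : ℝ, e = ENNReal.ofReal v ∧ 0 < v ∧
    {q : Fin n → ℤ | ∃ p : ℤ,
      |(∑ i, y i * q i) + (p : ℝ)| < (snormZ q) ^ (-v)}.Infinite}

/-- The Diophantine exponent of a column vector `A ∈ ℝⁿ`: the supremum of `v > 0` such
that `‖qA + p‖ < |q|^{−v}` (sup norm) for infinitely many `q ∈ ℤ`, some `p ∈ ℤⁿ`. -/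
noncomputable def omegaCol {n : ℕ} (A : Fin n → ℝ) : ℝ≥0∞ :=
  sSup {e : ℝ≥0∞ | ∃ v : ℝ, e = ENNReal.ofReal v ∧ 0 < v ∧
    {q : ℤ | ∃ p : Fin n → ℤ,
      ∀ i, |(q : ℝ) * A i + (p i : ℝ)| < |(q : ℝ)| ^ (-v)}.Infinite}

/-- The parametrizing map `x ↦ (x, (1,x)A)` of the codimension-one affine subspace
`𝓛 ⊆ ℝ^{m+1}` determined by the column vector `A ∈ M_{m+1,1}(ℝ)`. -/
def paramHyp {m : ℕ} (A : Fin (m + 1) → ℝ) (x : Fin m → ℝ) : Fin (m + 1) → ℝ :=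
  Fin.snoc x (A 0 + ∑ i, x i * A i.succ)


theorem oh_dist_pos (b : ℝ) (h : ∀ p : ℤ, b + p ≠ 0) : ∃ c > 0, ∀ p : ℤ, c ≤ |b + p| := by
  refine ⟨|b - round b|, ?_, fun p => ?_⟩
  · have := h (-round b)
    push_cast at this
    exact abs_pos.mpr (by rwa [← sub_eq_add_neg] at this)
  · have := round_le b (-p)
    push_cast at this
    simpa [sub_neg_eq_add] using this

theorem oh_fin_uniform {α : Type*} (F : Set α) (hF : F.Finite) (P : α → ℝ → Prop)
    (hP : ∀ a c c', c' ≤ c → P a c → P a c') (h : ∀ a ∈ F, ∃ c > 0, P a c) :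
    ∃ c > 0, ∀ a ∈ F, P a c := by
  induction F, hF using Set.Finite.induction_on with
  | empty => exact ⟨1, one_pos, by simp⟩
  | @insert a s _ _ ih =>
    obtain ⟨c, hc, h1⟩ := ih (fun b hb => h b (Set.mem_insert_of_mem _ hb))
    obtain ⟨d, hd, h2⟩ := h a (Set.mem_insert _ _)
    refine ⟨min c d, lt_min hc hd, fun b hb => ?_⟩
    rcases hb with rfl | hb
    · exact hP _ _ _ (min_le_right _ _) h2
    · exact hP _ _ _ (min_le_left _ _) (h1 b hb)

theorem oh_snorm_eq {n : ℕ} (q : Fin n → ℤ) : snormZ q = ‖q‖ := by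
  unfold snormZ
  rw [Pi.norm_def]
  have : (Finset.univ.sup fun b => ‖q b‖₊) = ((Finset.univ.sup fun i => (q i).natAbs : ℕ) : NNReal) := by
    rw [Nat.cast_finsetSup]
    congr 1
    ext i
    simp [← NNReal.natCast_natAbs]
  rw [this, NNReal.coe_natCast]

theorem oh_one_le_norm {n : ℕ} {q : Fin n → ℤ} (h : q ≠ 0) : 1 ≤ ‖q‖ := by
  obtain ⟨i, hi⟩ := Function.ne_iff.mp h
  refine le_trans ?_ (norm_le_pi_norm q i)
  rw [Int.norm_eq_abs]
  exact_mod_cast Int.one_le_abs hi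

theorem oh_dirichlet {n : ℕ} (hn : 0 < n) (y : Fin n → ℝ) (N : ℕ) (hN : 0 < N) :
    ∃ q : Fin n → ℤ, q ≠ 0 ∧ ‖q‖ ≤ N ∧ ∃ p : ℤ, |(∑ i, y i * q i) + p| < ((N : ℝ) ^ n)⁻¹ := by
  have hNn : (0 : ℝ) < (N : ℝ) ^ n := by positivity
  let L : (Fin n → Fin (N + 1)) → ℝ := fun a => ∑ i, y i * ((a i : ℕ) : ℝ)
  let f : (Fin n → Fin (N + 1)) → Fin (N ^ n) := fun a =>
    ⟨⌊Int.fract (L a) * (N : ℝ) ^ n⌋₊, by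
      rw [Nat.floor_lt (by have := Int.fract_nonneg (L a); positivity)]
      push_cast
      have := Int.fract_lt_one (L a)
      nlinarith⟩
  obtain ⟨a, b, hab, hf⟩ := Fintype.exists_ne_map_eq_of_card_lt f (by
    simp only [Fintype.card_fin, Fintype.card_pi, Finset.prod_const, Finset.card_univ]
    exact Nat.pow_lt_pow_left (Nat.lt_succ_self N) hn.ne')
  have hf' : ⌊Int.fract (L a) * (N : ℝ) ^ n⌋₊ = ⌊Int.fract (L b) * (N : ℝ) ^ n⌋₊ := by
    simpa [f] using hf
  refine ⟨fun i => ((a i : ℕ) : ℤ) - ((b i : ℕ) : ℤ), ?_, ?_, ⌊L b⌋ - ⌊L a⌋, ?_⟩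
  · intro h
    apply hab
    ext i
    have := congrFun h i
    simp only [Pi.zero_apply] at this
    omega
  · rw [pi_norm_le_iff_of_nonneg (by positivity)]
    intro i
    rw [Int.norm_eq_abs]
    have h1 := (a i).2
    have h2 := (b i).2
    have : |((a i : ℕ) : ℤ) - ((b i : ℕ) : ℤ)| ≤ N := by rw [abs_le]; omega
    exact_mod_cast this
  · have e : (∑ i, y i * (((((a i : ℕ) : ℤ) - ((b i : ℕ) : ℤ) : ℤ)) : ℝ)) + ((⌊L b⌋ - ⌊L a⌋ : ℤ) : ℝ)
        = Int.fract (L a) - Int.fract (L b) := by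
      unfold Int.fract
      push_cast
      simp only [mul_sub, Finset.sum_sub_distrib, L]
      ring
    rw [e]
    have n1 := Int.fract_nonneg (L a)
    have n2 := Int.fract_nonneg (L b)
    have h1 := Nat.floor_le (a := Int.fract (L a) * (N : ℝ) ^ n) (by positivity)
    have h2 := Nat.floor_le (a := Int.fract (L b) * (N : ℝ) ^ n) (by positivity)
    have h3 := Nat.lt_floor_add_one (Int.fract (L a) * (N : ℝ) ^ n)
    have h4 := Nat.lt_floor_add_one (Int.fract (L b) * (N : ℝ) ^ n)
    rw [hf'] at h1 h3
    have h5 : |(Int.fract (L a) - Int.fract (L b)) * (N : ℝ) ^ n| < 1 := by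
      rw [abs_lt, sub_mul]
      constructor <;> linarith
    rw [abs_mul, abs_of_pos hNn] at h5
    rw [← one_div]
    exact (lt_div_iff₀ hNn).mpr h5

theorem oh_ge_n {n : ℕ} (hn : 0 < n) (y : Fin n → ℝ) : (n : ℝ≥0∞) ≤ omegaExp y := by
  refine le_sSup ⟨n, by simp, by exact_mod_cast hn, ?_⟩
  intro hfin
  have key : ∀ q ∈ {q : Fin n → ℤ | ∃ p : ℤ,
      |(∑ i, y i * q i) + (p : ℝ)| < (snormZ q) ^ (-(n : ℝ))},
      ∃ c > 0, ∀ p : ℤ, c ≤ |(∑ i, y i * q i) + (p : ℝ)| := by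
    intro q hq
    have hq0 : q ≠ 0 := by
      rintro rfl
      obtain ⟨p, hp⟩ := hq
      rw [oh_snorm_eq, norm_zero, Real.zero_rpow (by simpa using hn.ne')] at hp
      exact absurd hp (not_lt.mpr (abs_nonneg _))
    apply oh_dist_pos
    intro p hp
    refine (Set.infinite_of_injective_forall_mem (f := fun k : ℕ => ((k : ℤ) + 1) • q) ?_ ?_) hfin
    · intro k l hkl
      have := smul_left_injective ℤ hq0 hkl
      simpa using this
    · intro k
      refine ⟨(k + 1) * p, ?_⟩
      have e : (∑ i, y i * (((((k : ℤ) + 1) • q) i : ℤ) : ℝ)) + (((k + 1) * p : ℤ) : ℝ) = 0 := by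
        have : (∑ i, y i * (((((k : ℤ) + 1) • q) i : ℤ) : ℝ)) = (k + 1) * ∑ i, y i * q i := by
          rw [Finset.mul_sum]
          refine Finset.sum_congr rfl fun i _ => ?_
          simp only [Pi.smul_apply, smul_eq_mul]
          push_cast
          ring
        rw [this]
        push_cast
        rw [← mul_add, hp, mul_zero]
      rw [e, abs_zero, oh_snorm_eq]
      apply Real.rpow_pos_of_pos
      rw [norm_pos_iff]
      exact smul_ne_zero (by positivity) hq0
  obtain ⟨c, hc, h⟩ := oh_fin_uniform _ hfin (fun q c => ∀ p : ℤ, c ≤ |(∑ i, y i * q i) + (p : ℝ)|)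
    (fun a c c' h h' p => h.trans (h' p)) key
  obtain ⟨N, hN⟩ := exists_nat_gt (c⁻¹)
  have hN0 : 0 < N := by
    have : (0 : ℝ) < N := lt_trans (by positivity) hN
    exact_mod_cast this
  obtain ⟨q, hq0, hqN, p, hp⟩ := oh_dirichlet hn y N hN0
  have hq1 := oh_one_le_norm hq0
  have hmem := h q ⟨p, by
    refine hp.trans_le ?_
    rw [oh_snorm_eq, Real.rpow_neg (by positivity), Real.rpow_natCast]
    gcongr⟩ p
  have : ((N : ℝ) ^ n)⁻¹ ≤ c := by
    rw [inv_le_comm₀ (by positivity) hc]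
    refine hN.le.trans ?_
    exact le_self_pow₀ (by exact_mod_cast hN0) hn.ne'
  linarith

theorem oh_ge_col {m : ℕ} (A : Fin (m + 1) → ℝ) (x : Fin m → ℝ) :
    omegaCol A ≤ omegaExp (paramHyp A x) := by
  refine sSup_le ?_
  rintro e ⟨v, rfl, hv, hinf⟩
  refine le_of_forall_lt fun a ha => ?_
  obtain ⟨w, hw0, haw, hwv⟩ := ENNReal.lt_iff_exists_real_btwn.mp ha
  refine haw.trans_le ?_
  rcases hw0.eq_or_lt with rfl | hw0
  · simp
  have hwv : w < v := by
    have h' : ENNReal.ofReal w < ENNReal.ofReal v := hwv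
    exact (ENNReal.ofReal_lt_ofReal_iff hv).mp h'
  refine le_sSup ⟨w, rfl, hw0, ?_⟩
  set C : ℝ := 1 + ∑ i, |x i| with hC
  have hC1 : 1 ≤ C := by
    have : 0 ≤ ∑ i, |x i| := Finset.sum_nonneg fun i _ => abs_nonneg _
    linarith
  set B : ℝ := 1 + ‖A‖ with hB
  have hB1 : 1 ≤ B := by have := norm_nonneg A; linarith
  obtain ⟨T, hT⟩ : ∃ T : ℕ, ∀ t : ℝ, (T : ℝ) ≤ t → C * B ^ w * t ^ w ≤ t ^ v := by
    have := (tendsto_rpow_atTop (sub_pos.mpr hwv)).eventually_ge_atTop (C * B ^ w)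
    obtain ⟨T, hT⟩ := Filter.eventually_atTop.mp this
    refine ⟨⌈max T 1⌉₊, fun t ht => ?_⟩
    have ht' := (Nat.le_ceil _).trans ht
    have h1 := hT t ((le_max_left _ _).trans ht')
    have ht0 : 0 < t := lt_of_lt_of_le one_pos ((le_max_right _ _).trans ht')
    have : t ^ v = t ^ (v - w) * t ^ w := by rw [← Real.rpow_add ht0]; ring_nf
    rw [this]
    gcongr
  have hinf2 : ({q : ℤ | ∃ p : Fin (m + 1) → ℤ,
      ∀ i, |(q : ℝ) * A i + (p i : ℝ)| < |(q : ℝ)| ^ (-v)} \ Set.Icc (-(T : ℤ)) T).Infinite :=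
    hinf.sdiff (Set.finite_Icc _ _)
  have hch : ∀ q : ℤ, ∃ p : Fin (m + 1) → ℤ, q ∈ ({q : ℤ | ∃ p : Fin (m + 1) → ℤ,
      ∀ i, |(q : ℝ) * A i + (p i : ℝ)| < |(q : ℝ)| ^ (-v)} \ Set.Icc (-(T : ℤ)) T) →
      ∀ i, |(q : ℝ) * A i + (p i : ℝ)| < |(q : ℝ)| ^ (-v) := by
    intro q
    by_cases h : ∃ p : Fin (m + 1) → ℤ, ∀ i, |(q : ℝ) * A i + (p i : ℝ)| < |(q : ℝ)| ^ (-v)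
    · exact ⟨h.choose, fun _ => h.choose_spec⟩
    · exact ⟨0, fun hq => absurd hq.1 h⟩
  choose p hp using hch
  refine (hinf2.image (f := fun q => (Fin.snoc (fun i : Fin m => p q i.succ) q : Fin (m + 1) → ℤ))
    ?_).mono ?_
  · intro q _ q' _ h
    have := congrFun h (Fin.last m)
    simpa using this
  · rintro _ ⟨q, hq, rfl⟩
    have hpq := hp q hq
    have hqT : (T : ℝ) < |(q : ℝ)| := by
      have : (T : ℤ) < |q| := by
        by_contra hh
        exact hq.2 (abs_le.mp (not_lt.mp hh))
      exact_mod_cast this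
    have hq0 : q ≠ 0 := by
      rintro rfl
      simp at hqT
      have : (0 : ℝ) ≤ T := by positivity
      linarith
    have hq1 : (1 : ℝ) ≤ |(q : ℝ)| := by exact_mod_cast Int.one_le_abs hq0
    refine ⟨p q 0, ?_⟩
    have e : (∑ i, paramHyp A x i *
        ((Fin.snoc (fun i : Fin m => p q i.succ) q : Fin (m + 1) → ℤ) i : ℝ)) + (p q 0 : ℝ)
        = (q * A 0 + p q 0) + ∑ i : Fin m, x i * (q * A i.succ + p q i.succ) := by
      rw [Fin.sum_univ_castSucc]
      simp only [paramHyp, Fin.snoc_castSucc, Fin.snoc_last, mul_add, add_mul, Finset.sum_add_distrib,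
        Finset.sum_mul]
      have : ∀ i, x i * A i.succ * (q : ℝ) = x i * (q * A i.succ) := fun i => by ring
      simp only [this]
      ring
    dsimp only
    rw [e, oh_snorm_eq]
    set Q : Fin (m + 1) → ℤ := Fin.snoc (fun i : Fin m => p q i.succ) q
    have hQ0 : Q ≠ 0 := by
      intro h
      apply hq0
      have := congrFun h (Fin.last m)
      simpa [Q] using this
    have hQ1 := oh_one_le_norm hQ0
    have hv1 : |(q : ℝ)| ^ (-v) ≤ 1 := Real.rpow_le_one_of_one_le_of_nonpos hq1 (by linarith)
    have hQ : ‖Q‖ ≤ B * |(q : ℝ)| := by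
      rw [pi_norm_le_iff_of_nonneg (by positivity)]
      intro i
      rw [Int.norm_eq_abs]
      refine Fin.lastCases ?_ (fun i => ?_) i
      · simp only [Q, Fin.snoc_last]
        nlinarith
      · simp only [Q, Fin.snoc_castSucc]
        have h1 := hpq i.succ
        have h2 := norm_le_pi_norm A i.succ
        rw [Real.norm_eq_abs] at h2
        have h3 : |((p q i.succ : ℤ) : ℝ)| ≤ |(q : ℝ) * A i.succ + p q i.succ| + |(q : ℝ) * A i.succ| := by
          have := abs_sub ((q : ℝ) * A i.succ + p q i.succ) ((q : ℝ) * A i.succ)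
          simpa using this
        rw [abs_mul] at h3
        nlinarith [abs_nonneg (q : ℝ)]
    have h1 : |(q * A 0 + p q 0) + ∑ i : Fin m, x i * (q * A i.succ + p q i.succ)|
        < C * |(q : ℝ)| ^ (-v) := by
      have h2 : |∑ i : Fin m, x i * (q * A i.succ + p q i.succ)| ≤ (∑ i, |x i|) * |(q : ℝ)| ^ (-v) := by
        rw [Finset.sum_mul]
        refine (Finset.abs_sum_le_sum_abs _ _).trans (Finset.sum_le_sum fun i _ => ?_)
        rw [abs_mul]
        exact mul_le_mul_of_nonneg_left (hpq i.succ).le (abs_nonneg _)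
      have h3 := hpq 0
      have h4 := abs_add_le (q * A 0 + p q 0) (∑ i : Fin m, x i * (q * A i.succ + p q i.succ))
      rw [hC, add_mul, one_mul]
      linarith
    refine h1.trans_le ?_
    have h5 : (B * |(q : ℝ)|) ^ (-w) ≤ ‖Q‖ ^ (-w) :=
      Real.rpow_le_rpow_of_nonpos (by linarith) hQ (by linarith)
    refine le_trans ?_ h5
    have h6 := hT _ hqT.le
    have hB0 : 0 < B := by linarith
    have hqp : 0 < |(q : ℝ)| := by linarith
    rw [Real.rpow_neg (by positivity), Real.rpow_neg (by positivity), Real.mul_rpow hB0.le hqp.le,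
      ← div_eq_mul_inv, ← one_div, div_le_div_iff₀ (by positivity) (by positivity)]
    linarith

theorem oh_slab {m : ℕ} (R : ℝ) (hR : 0 ≤ R) (c0 : ℝ) (c : Fin m → ℝ) (i : Fin m) (hi : c i ≠ 0)
    (ε : ℝ) :
    volume {x : Fin m → ℝ | x ∈ Set.Icc (fun _ => -R) (fun _ => R) ∧ |c0 + ∑ j, c j * x j| < ε} ≤
      ENNReal.ofReal ((2 * R) ^ (m - 1) * (2 * ε) / |c i|) := by
  classical
  set M : Matrix (Fin m) (Fin m) ℝ := (1 : Matrix (Fin m) (Fin m) ℝ).updateRow i c with hM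
  have hdet : M.det = c i := by
    rw [hM, ← Matrix.cramer_transpose_apply, Matrix.transpose_one, Matrix.cramer_one]
    rfl
  have hdet' : LinearMap.det (Matrix.toLin' M) = c i := by rw [LinearMap.det_toLin', hdet]
  have hsub : {x : Fin m → ℝ | x ∈ Set.Icc (fun _ => -R) (fun _ => R) ∧ |c0 + ∑ j, c j * x j| < ε} ⊆
      (Matrix.toLin' M) ⁻¹' (Set.univ.pi
        (Function.update (fun _ => Set.Icc (-R) R) i (Set.Ioo (-ε - c0) (ε - c0)))) := by
    rintro x ⟨hx, hxε⟩
    simp only [Set.mem_preimage, Set.mem_pi, Set.mem_univ, true_implies, Matrix.toLin'_apply]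
    intro j
    by_cases hj : j = i
    · subst hj
      simp only [Function.update_self, Matrix.mulVec, hM, Matrix.updateRow_self, dotProduct]
      rw [abs_lt] at hxε
      constructor <;> linarith [hxε.1, hxε.2]
    · rw [Function.update_of_ne hj]
      simp only [Matrix.mulVec, hM]
      rw [Matrix.updateRow_ne hj]
      have : (1 : Matrix (Fin m) (Fin m) ℝ) j ⬝ᵥ x = x j := by
        have := congrFun (Matrix.one_mulVec x) j
        simpa [Matrix.mulVec] using this
      rw [this]
      exact ⟨hx.1 j, hx.2 j⟩
  refine (measure_mono hsub).trans ?_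
  rw [Measure.addHaar_preimage_linearMap _ (by rw [hdet']; exact hi), hdet', volume_pi_pi]
  have : ∀ j, volume (Function.update (fun _ : Fin m => Set.Icc (-R) R) i (Set.Ioo (-ε - c0) (ε - c0)) j)
      = Function.update (fun _ : Fin m => ENNReal.ofReal (2 * R)) i (ENNReal.ofReal (2 * ε)) j := by
    intro j
    by_cases hj : j = i
    · subst hj
      simp only [Function.update_self, Real.volume_Ioo]
      congr 1; ring
    · simp only [Function.update_of_ne hj, Real.volume_Icc]
      congr 1; ring
  simp only [this]
  rw [Finset.prod_update_of_mem (Finset.mem_univ _), Finset.prod_const,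
    Finset.card_sdiff_of_subset (Finset.subset_univ _)]
  simp only [Finset.card_univ, Fintype.card_fin, Finset.card_singleton]
  rw [← ENNReal.ofReal_pow (by positivity), mul_comm (ENNReal.ofReal (2 * ε)),
    ← ENNReal.ofReal_mul (by positivity), ← ENNReal.ofReal_mul (by positivity)]
  apply le_of_eq
  congr 1
  rw [abs_inv]
  ring

theorem oh_box {m : ℕ} (R : ℝ) (hR : 0 ≤ R) :
    volume (Set.Icc (fun _ => -R) (fun _ => R) : Set (Fin m → ℝ)) = ENNReal.ofReal ((2 * R) ^ m) := by
  rw [Real.volume_Icc_pi]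
  simp only [Finset.prod_const, Finset.card_univ, Fintype.card_fin]
  rw [← ENNReal.ofReal_pow (by linarith)]
  congr 2; ring

theorem oh_sum_bound {m : ℕ} (R : ℝ) (hR : 0 ≤ R) (c : Fin m → ℝ) (d : ℝ)
    (hd : ∀ i, |c i| ≤ d) (x : Fin m → ℝ) (hx : x ∈ Set.Icc (fun _ => -R) (fun _ => R)) :
    |∑ j, c j * x j| ≤ m * R * d := by
  refine (Finset.abs_sum_le_sum_abs _ _).trans ?_
  have : ∀ j ∈ (Finset.univ : Finset (Fin m)), |c j * x j| ≤ R * d := by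
    intro j _
    rw [abs_mul, mul_comm]
    have h1 : |x j| ≤ R := abs_le.mpr ⟨hx.1 j, hx.2 j⟩
    exact mul_le_mul h1 (hd j) (abs_nonneg _) hR
  refine (Finset.sum_le_sum this).trans ?_
  simp [mul_assoc]

/-- measure of a slab in terms of the size of all coefficients -/
theorem oh_pair {m : ℕ} (hm : 0 < m) (R : ℝ) (hR : 0 ≤ R) : ∃ K : ℝ, 0 ≤ K ∧
    ∀ (c0 : ℝ) (c : Fin m → ℝ) (δ ε : ℝ), 0 < δ → 0 < ε → (δ ≤ |c0| ∨ ∃ i, δ ≤ |c i|) →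
    volume {x : Fin m → ℝ | x ∈ Set.Icc (fun _ => -R) (fun _ => R) ∧ |c0 + ∑ j, c j * x j| < ε} ≤
      ENNReal.ofReal (K * (ε / δ)) := by
  refine ⟨2 * (2 * R) ^ m + (2 * R) ^ (m - 1) * (4 * (m * R + 1)), by positivity, ?_⟩
  intro c0 c δ ε hδ hε h
  rcases le_or_gt ε (δ / 2) with hle | hgt
  · have : Nonempty (Fin m) := ⟨⟨0, hm⟩⟩
    obtain ⟨i, hi⟩ := Finite.exists_max (fun i => |c i|)
    rcases lt_or_ge (|c i| * (2 * (m * R + 1))) δ with hsm | hbig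
    · -- empty
      have : {x : Fin m → ℝ | x ∈ Set.Icc (fun _ => -R) (fun _ => R) ∧ |c0 + ∑ j, c j * x j| < ε} = ∅ := by
        rw [Set.eq_empty_iff_forall_notMem]
        rintro x ⟨hx, hxε⟩
        have h1 := oh_sum_bound R hR c _ hi x hx
        have hmR : 0 ≤ m * R := by positivity
        have hc := abs_nonneg (c i)
        rcases h with h | ⟨j, h⟩
        · have := abs_sub (c0 + ∑ j, c j * x j) (∑ j, c j * x j)
          rw [add_sub_cancel_right] at this
          nlinarith
        · have := hi j
          nlinarith
      rw [this]; simp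
    · have hci : 0 < |c i| := by
        by_contra hh
        have : |c i| = 0 := le_antisymm (not_lt.mp hh) (abs_nonneg _)
        rw [this] at hbig
        linarith
      refine (oh_slab R hR c0 c i (abs_pos.mp hci) ε).trans (ENNReal.ofReal_le_ofReal ?_)
      have h1 : ε / |c i| ≤ 2 * (m * R + 1) * (ε / δ) := by
        rw [mul_div_assoc', div_le_div_iff₀ hci hδ]
        nlinarith
      calc (2 * R) ^ (m - 1) * (2 * ε) / |c i| = (2 * R) ^ (m - 1) * 2 * (ε / |c i|) := by ring
        _ ≤ (2 * R) ^ (m - 1) * 2 * (2 * (m * R + 1) * (ε / δ)) := by gcongr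
        _ ≤ _ := by
          have : 0 ≤ 2 * (2 * R) ^ m * (ε / δ) := by positivity
          linarith
  · refine (measure_mono (fun x hx => hx.1)).trans ?_
    rw [oh_box R hR]
    refine ENNReal.ofReal_le_ofReal ?_
    have h1 : 1 ≤ 2 * (ε / δ) := by
      rw [mul_div_assoc', le_div_iff₀ hδ]; linarith
    have h2 : 0 ≤ (2 * R) ^ (m - 1) * (4 * (m * R + 1)) * (ε / δ) := by positivity
    have h3 : 0 ≤ (2 * R) ^ m := by positivity
    nlinarith

theorem oh_large {m : ℕ} (hm : 0 < m) (R : ℝ) (hR : 0 ≤ R) : ∃ K : ℝ, 0 ≤ K ∧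
    ∀ (b : ℝ) (c : Fin m → ℝ) (ε : ℝ), 0 < ε →
    volume {x : Fin m → ℝ | x ∈ Set.Icc (fun _ => -R) (fun _ => R) ∧ ∃ p : ℤ,
      (1 / 2 ≤ |b + p| ∨ ∃ i, 1 / 2 ≤ |c i|) ∧ |b + p + ∑ j, c j * x j| < ε} ≤
      ENNReal.ofReal (K * ε) := by
  have hmR : 0 ≤ m * R := by positivity
  refine ⟨4 * (2 * R) ^ m +
    (2 * (m * R) + 3 * (4 * (m * R + 1))) * ((2 * R) ^ (m - 1) * 2), by positivity, ?_⟩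
  intro b c ε hε
  rcases le_or_gt ε (1 / 4) with hle | hgt
  · have : Nonempty (Fin m) := ⟨⟨0, hm⟩⟩
    obtain ⟨i, hi⟩ := Finite.exists_max (fun i => |c i|)
    have hc := abs_nonneg (c i)
    rcases lt_or_ge (|c i| * (4 * (m * R + 1))) 1 with hsm | hbig
    · have : {x : Fin m → ℝ | x ∈ Set.Icc (fun _ => -R) (fun _ => R) ∧ ∃ p : ℤ,
          (1 / 2 ≤ |b + p| ∨ ∃ i, 1 / 2 ≤ |c i|) ∧ |b + p + ∑ j, c j * x j| < ε} = ∅ := by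
        rw [Set.eq_empty_iff_forall_notMem]
        rintro x ⟨hx, p, h, hxε⟩
        have h1 := oh_sum_bound R hR c _ hi x hx
        rcases h with h | ⟨j, h⟩
        · have := abs_sub (b + p + ∑ j, c j * x j) (∑ j, c j * x j)
          rw [add_sub_cancel_right] at this
          nlinarith
        · have := hi j
          nlinarith
      rw [this]; simp
    · have hci : 0 < |c i| := by
        by_contra hh
        have : |c i| = 0 := le_antisymm (not_lt.mp hh) (abs_nonneg _)
        rw [this] at hbig
        linarith
      set L : ℝ := m * R * |c i| + 1 with hL
      have hL0 : 0 ≤ L := by positivity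
      set P : Finset ℤ := Finset.Icc ⌈-b - L⌉ ⌊-b + L⌋ with hP
      have hcard : (P.card : ℝ) ≤ 2 * L + 1 := by
        rw [hP, Int.card_Icc]
        have h1 : ((⌊-b + L⌋ + 1 - ⌈-b - L⌉ : ℤ) : ℝ) ≤ 2 * L + 1 := by
          push_cast
          linarith [Int.floor_le (-b + L), Int.le_ceil (-b - L)]
        have h2 : (((⌊-b + L⌋ + 1 - ⌈-b - L⌉).toNat : ℤ) : ℝ) ≤ 2 * L + 1 := by
          rw [Int.toNat_eq_max, Int.cast_max]
          exact max_le h1 (by push_cast; linarith)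
        exact_mod_cast h2
      have hsub : {x : Fin m → ℝ | x ∈ Set.Icc (fun _ => -R) (fun _ => R) ∧ ∃ p : ℤ,
          (1 / 2 ≤ |b + p| ∨ ∃ i, 1 / 2 ≤ |c i|) ∧ |b + p + ∑ j, c j * x j| < ε} ⊆
          ⋃ p ∈ P, {x : Fin m → ℝ | x ∈ Set.Icc (fun _ => -R) (fun _ => R) ∧
            |(b + p) + ∑ j, c j * x j| < ε} := by
        rintro x ⟨hx, p, h, hxε⟩
        have h1 := oh_sum_bound R hR c _ hi x hx
        have h2 := abs_sub (b + p + ∑ j, c j * x j) (∑ j, c j * x j)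
        rw [add_sub_cancel_right] at h2
        have h3 : |b + p| ≤ L := by linarith
        rw [abs_le] at h3
        simp only [Set.mem_iUnion]
        refine ⟨p, ?_, hx, hxε⟩
        rw [hP, Finset.mem_Icc, Int.ceil_le, Int.le_floor]
        constructor <;> linarith
      refine (measure_mono hsub).trans ((measure_biUnion_finset_le _ _).trans ?_)
      refine (Finset.sum_le_sum fun (p : ℤ) _ => oh_slab R hR (b + (p : ℝ)) c i (abs_pos.mp hci) ε).trans ?_
      rw [Finset.sum_const, nsmul_eq_mul, ← ENNReal.ofReal_natCast,
        ← ENNReal.ofReal_mul (by positivity)]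
      refine ENNReal.ofReal_le_ofReal ?_
      have h4 : (2 * L + 1) / |c i| ≤ 2 * (m * R) + 3 * (4 * (m * R + 1)) := by
        rw [div_le_iff₀ hci, hL]
        nlinarith
      calc (P.card : ℝ) * ((2 * R) ^ (m - 1) * (2 * ε) / |c i|)
          ≤ (2 * L + 1) * ((2 * R) ^ (m - 1) * (2 * ε) / |c i|) := by gcongr
        _ = (2 * L + 1) / |c i| * ((2 * R) ^ (m - 1) * 2) * ε := by ring
        _ ≤ (2 * (m * R) + 3 * (4 * (m * R + 1))) * ((2 * R) ^ (m - 1) * 2) * ε := by gcongr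
        _ ≤ _ := by
          have : 0 ≤ 4 * (2 * R) ^ m * ε := by positivity
          linarith
  · refine (measure_mono (fun x hx => hx.1)).trans ?_
    rw [oh_box R hR]
    refine ENNReal.ofReal_le_ofReal ?_
    have h2 : 0 ≤ (2 * (m * R) + 3 * (4 * (m * R + 1))) * ((2 * R) ^ (m - 1) * 2) * ε := by positivity
    have h3 : 0 ≤ (2 * R) ^ m := by positivity
    nlinarith

theorem oh_sep {n : ℕ} (A : Fin n → ℝ) (u : ℝ) (hu : 0 < u) (h : omegaCol A < ENNReal.ofReal u) :
    ∃ c > 0, ∀ q : ℤ, q ≠ 0 → ∀ p : Fin n → ℤ,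
      c * |(q : ℝ)| ^ (-u) ≤ ‖fun i => (q : ℝ) * A i + (p i : ℝ)‖ := by
  set F : Set ℤ := {q : ℤ | ∃ p : Fin n → ℤ,
      ∀ i, |(q : ℝ) * A i + (p i : ℝ)| < |(q : ℝ)| ^ (-u)} with hF
  have hfin : F.Finite := by
    by_contra hinf
    have h' : ENNReal.ofReal u ≤ omegaCol A := le_sSup ⟨u, rfl, hu, hinf⟩
    exact absurd h' (not_le.mpr h)
  have key : ∀ q ∈ F, ∃ c > 0, q ≠ 0 → ∀ p : Fin n → ℤ, c ≤ ‖fun i => (q : ℝ) * A i + (p i : ℝ)‖ := by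
    intro q _
    by_cases hq0 : q = 0
    · exact ⟨1, one_pos, fun h => absurd hq0 h⟩
    have : ∃ i, ∀ p : ℤ, (q : ℝ) * A i + p ≠ 0 := by
      by_contra! hh
      choose p hp using hh
      refine (Set.infinite_of_injective_forall_mem (f := fun k : ℕ => ((k : ℤ) + 1) * q) ?_ ?_) hfin
      · intro k l hkl
        have := mul_right_cancel₀ hq0 hkl
        simpa using this
      · intro k
        refine ⟨fun i => (k + 1) * p i, fun i => ?_⟩
        have e : ((((k : ℤ) + 1) * q : ℤ) : ℝ) * A i + (((k + 1) * p i : ℤ) : ℝ) = 0 := by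
          have := hp i
          push_cast
          linear_combination ((k : ℝ) + 1) * this
        rw [e, abs_zero]
        apply Real.rpow_pos_of_pos
        rw [abs_pos]
        have : ((k : ℤ) + 1) * q ≠ 0 := mul_ne_zero (by positivity) hq0
        exact_mod_cast this
    obtain ⟨i, hi⟩ := this
    obtain ⟨c, hc, hc'⟩ := oh_dist_pos _ hi
    refine ⟨c, hc, fun _ p => (hc' (p i)).trans ?_⟩
    exact norm_le_pi_norm (fun i => (q : ℝ) * A i + (p i : ℝ)) i
  obtain ⟨c, hc, hc'⟩ := oh_fin_uniform F hfin
    (fun q c => q ≠ 0 → ∀ p : Fin n → ℤ, c ≤ ‖fun i => (q : ℝ) * A i + (p i : ℝ)‖)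
    (fun a c c' h h' h0 p => h.trans (h' h0 p)) key
  refine ⟨min c 1, lt_min hc one_pos, fun q hq0 p => ?_⟩
  have hq1 : (1 : ℝ) ≤ |(q : ℝ)| := by exact_mod_cast Int.one_le_abs hq0
  have h1 : |(q : ℝ)| ^ (-u) ≤ 1 := Real.rpow_le_one_of_one_le_of_nonpos hq1 (by linarith)
  have h0 : 0 ≤ |(q : ℝ)| ^ (-u) := by positivity
  by_cases hq : q ∈ F
  · have h2 := hc' q hq hq0 p
    have h3 : min c 1 ≤ c := min_le_left _ _
    have h4 : 0 < min c 1 := lt_min hc one_pos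
    nlinarith
  · have : ∃ i, |(q : ℝ)| ^ (-u) ≤ |(q : ℝ) * A i + (p i : ℝ)| := by
      by_contra! hh
      exact hq ⟨p, hh⟩
    obtain ⟨i, hi⟩ := this
    have h2 := norm_le_pi_norm (fun i => (q : ℝ) * A i + (p i : ℝ)) i
    rw [Real.norm_eq_abs] at h2
    have h3 : min c 1 ≤ 1 := min_le_right _ _
    nlinarith

theorem oh_summable_small {n : ℕ} (A : Fin n → ℝ) (u v c : ℝ) (hu : 1 < u) (huv : u < v) (hc : 0 < c)
    (hsep : ∀ q : ℤ, q ≠ 0 → ∀ p : Fin n → ℤ,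
      c * |(q : ℝ)| ^ (-u) ≤ ‖fun i => (q : ℝ) * A i + (p i : ℝ)‖) :
    Summable fun s : {s : ℤ × (Fin n → ℤ) // s.1 ≠ 0 ∧
        ‖fun i => (s.1 : ℝ) * A i + (s.2 i : ℝ)‖ < 1 / 2} =>
      |(s.1.1 : ℝ)| ^ (-v) / ‖fun i => (s.1.1 : ℝ) * A i + (s.1.2 i : ℝ)‖ := by
  have hu0 : 0 < u := by linarith
  set D : ℤ × (Fin n → ℤ) → (Fin n → ℝ) := fun s => fun i => (s.1 : ℝ) * A i + (s.2 i : ℝ) with hD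
  change Summable fun s : {s : ℤ × (Fin n → ℤ) // s.1 ≠ 0 ∧ ‖D s‖ < 1 / 2} =>
      |(s.1.1 : ℝ)| ^ (-v) / ‖D s.1‖
  have hDpos : ∀ s : ℤ × (Fin n → ℤ), s.1 ≠ 0 → 0 < ‖D s‖ := by
    intro s hs
    refine lt_of_lt_of_le ?_ (hsep s.1 hs s.2)
    have : (0 : ℝ) < |(s.1 : ℝ)| := by rw [abs_pos]; exact_mod_cast hs
    positivity
  have hk : ∀ s : {s : ℤ × (Fin n → ℤ) // s.1 ≠ 0 ∧ ‖D s‖ < 1 / 2}, ∃ k : ℕ,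
      (1 / 2 : ℝ) ^ (k + 1) < ‖D s.1‖ ∧ ‖D s.1‖ ≤ (1 / 2 : ℝ) ^ k := fun s =>
    exists_nat_pow_near_of_lt_one (hDpos _ s.2.1) (by linarith [s.2.2]) (by norm_num) (by norm_num)
  choose k hk1 hk2 using hk
  set G : ℝ := (c / 2) ^ (1 / u) with hG
  set t : ℝ := 2 ^ (1 / u) with ht
  have hG0 : 0 < G := by positivity
  have ht0 : 0 < t := by positivity
  have hGu : G ^ u = c / 2 := by
    rw [hG, ← Real.rpow_mul (by positivity), one_div_mul_cancel hu0.ne', Real.rpow_one]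
  have htu : t ^ u = 2 := by
    rw [ht, ← Real.rpow_mul (by positivity), one_div_mul_cancel hu0.ne', Real.rpow_one]
  have gap : ∀ (s : ℤ × (Fin n → ℤ)) (j : ℕ), s.1 ≠ 0 → ‖D s‖ ≤ 2 * (1 / 2 : ℝ) ^ j →
      G * t ^ j ≤ |(s.1 : ℝ)| := by
    intro s j hs hj
    have hq : (0 : ℝ) < |(s.1 : ℝ)| := by rw [abs_pos]; exact_mod_cast hs
    have h1 := (hsep s.1 hs s.2).trans hj
    rw [Real.rpow_neg hq.le, ← div_eq_mul_inv, div_le_iff₀ (by positivity)] at h1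
    have h2 : (G * t ^ j) ^ u ≤ |(s.1 : ℝ)| ^ u := by
      rw [Real.mul_rpow hG0.le (by positivity), hGu, ← Real.rpow_natCast, ← Real.rpow_mul ht0.le,
        mul_comm (j : ℝ), Real.rpow_mul ht0.le, htu, Real.rpow_natCast]
      have h3 : (2 : ℝ) ^ j * (1 / 2) ^ j = 1 := by rw [← mul_pow]; norm_num
      have h4 : (0 : ℝ) < 2 ^ j := by positivity
      calc c / 2 * 2 ^ j ≤ (2 * (1 / 2) ^ j * |(s.1 : ℝ)| ^ u) / 2 * 2 ^ j := by gcongr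
        _ = (2 ^ j * (1 / 2) ^ j) * |(s.1 : ℝ)| ^ u := by ring
        _ = _ := by rw [h3, one_mul]
    exact (Real.rpow_le_rpow_iff (by positivity) hq.le hu0).mp h2
  let φ : {s : ℤ × (Fin n → ℤ) // s.1 ≠ 0 ∧ ‖D s‖ < 1 / 2} → ℕ × ℤ := fun s =>
    (k s, ⌊(s.1.1 : ℝ) / (G * t ^ k s)⌋)
  have hφ : Function.Injective φ := by
    intro s s' h
    have hkk : k s = k s' := congrArg Prod.fst h
    have hfl : ⌊(s.1.1 : ℝ) / (G * t ^ k s)⌋ = ⌊(s'.1.1 : ℝ) / (G * t ^ k s')⌋ := congrArg Prod.snd h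
    rw [← hkk] at hfl
    have hg : 0 < G * t ^ k s := by positivity
    have hDs : D (s.1 - s'.1) = D s.1 - D s'.1 := by
      ext i
      simp only [hD, Prod.fst_sub, Prod.snd_sub, Pi.sub_apply]
      push_cast
      ring
    have hle := norm_sub_le (D s.1) (D s'.1)
    rw [← hDs] at hle
    have hq : s.1.1 = s'.1.1 := by
      by_contra hne
      have h1 := Int.abs_sub_lt_one_of_floor_eq_floor hfl
      rw [← sub_div, abs_div, abs_of_pos hg, div_lt_one hg] at h1
      have h2 := gap (s.1 - s'.1) (k s) (sub_ne_zero.mpr hne) (by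
        have := hk2 s
        have h3 := hk2 s'
        rw [← hkk] at h3
        linarith)
      simp only [Prod.fst_sub] at h2
      push_cast at h2
      linarith
    have hp : s.1.2 = s'.1.2 := by
      ext i
      have h1 := norm_le_pi_norm (D (s.1 - s'.1)) i
      have h2 : D (s.1 - s'.1) i = ((s.1.2 i - s'.1.2 i : ℤ) : ℝ) := by
        simp [hD, hq]
      rw [h2, Real.norm_eq_abs] at h1
      have h3 : |((s.1.2 i - s'.1.2 i : ℤ) : ℝ)| < 1 := by linarith [s.2.2, s'.2.2]
      have h4 : |s.1.2 i - s'.1.2 i| < 1 := by exact_mod_cast h3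
      rw [Int.abs_lt_one_iff] at h4
      omega
    exact Subtype.ext (Prod.ext hq hp)
  have hρ : 2 * t ^ (-v) < 1 := by
    have h1 : 2 < t ^ v := by
      rw [← htu]
      apply Real.rpow_lt_rpow_of_exponent_lt _ huv
      exact Real.one_lt_rpow (by norm_num) (by positivity)
    rw [Real.rpow_neg ht0.le, ← div_eq_mul_inv, div_lt_one (by positivity)]
    exact h1
  have hF : Summable fun x : ℕ × ℤ => (2 * t ^ (-v)) ^ x.1 * |(x.2 : ℝ)| ^ (-v) :=
    Summable.mul_of_nonneg (summable_geometric_of_lt_one (by positivity) hρ)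
      (Real.summable_abs_int_rpow (by linarith)) (fun _ => by positivity) (fun _ => by positivity)
  refine Summable.of_nonneg_of_le (fun s => by positivity) (fun s => ?_)
    ((hF.comp_injective hφ).mul_left (2 * (G / 2) ^ (-v)))
  simp only [Function.comp, φ]
  set g : ℝ := G * t ^ k s with hgdef
  set j : ℤ := ⌊(s.1.1 : ℝ) / g⌋ with hj
  have hg : 0 < g := by positivity
  have hqg : g ≤ |(s.1.1 : ℝ)| := gap s.1 (k s) s.2.1 (by
    have := hk2 s
    have h0 : (0 : ℝ) ≤ (1 / 2) ^ k s := by positivity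
    linarith)
  have hj0 : j ≠ 0 := by
    intro h0
    rw [hj, Int.floor_eq_zero_iff] at h0
    have h1 := h0.1
    have h2 := h0.2
    rw [div_lt_one hg] at h2
    rw [le_div_iff₀ hg, zero_mul] at h1
    rw [abs_of_nonneg h1] at hqg
    linarith
  have hjq : |(j : ℝ)| * (g / 2) ≤ |(s.1.1 : ℝ)| := by
    have h1 := Int.floor_le ((s.1.1 : ℝ) / g)
    have h2 := Int.lt_floor_add_one ((s.1.1 : ℝ) / g)
    rw [← hj] at h1 h2
    have h3 : 1 ≤ |(s.1.1 : ℝ) / g| := by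
      rw [abs_div, abs_of_pos hg, le_div_iff₀ hg]; linarith
    have h4 : |(j : ℝ)| ≤ 2 * |(s.1.1 : ℝ) / g| := by
      have := abs_le.mp (le_refl |(s.1.1 : ℝ) / g|)
      rw [abs_le]
      constructor <;> linarith
    have h5 : |(s.1.1 : ℝ) / g| * g = |(s.1.1 : ℝ)| := by
      rw [abs_div, abs_of_pos hg]; field_simp
    calc |(j : ℝ)| * (g / 2) ≤ 2 * |(s.1.1 : ℝ) / g| * (g / 2) := by gcongr
      _ = |(s.1.1 : ℝ) / g| * g := by ring
      _ = _ := h5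
  have hjp : (0 : ℝ) < |(j : ℝ)| := by rw [abs_pos]; exact_mod_cast hj0
  have e1 : |(s.1.1 : ℝ)| ^ (-v) ≤ (|(j : ℝ)| * (g / 2)) ^ (-v) :=
    Real.rpow_le_rpow_of_nonpos (by positivity) hjq (by linarith)
  have e2 : (|(j : ℝ)| * (g / 2)) ^ (-v) = (G / 2) ^ (-v) * (t ^ (-v)) ^ k s * |(j : ℝ)| ^ (-v) := by
    rw [Real.mul_rpow (by positivity) (by positivity)]
    have : g / 2 = (G / 2) * t ^ k s := by rw [hgdef]; ring
    rw [this, Real.mul_rpow (by positivity) (by positivity), ← Real.rpow_natCast t, ← Real.rpow_mul ht0.le,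
      mul_comm ((k s : ℕ) : ℝ), Real.rpow_mul ht0.le, Real.rpow_natCast]
    ring
  have e3 : 1 / ‖D s.1‖ ≤ 2 * 2 ^ k s := by
    have h1 := hk1 s
    rw [div_le_iff₀ (hDpos _ s.2.1)]
    have h3 : (2 : ℝ) ^ (k s + 1) * (1 / 2) ^ (k s + 1) = 1 := by rw [← mul_pow]; norm_num
    rw [← pow_succ']
    refine h3.symm.le.trans ?_
    gcongr
  calc |(s.1.1 : ℝ)| ^ (-v) / ‖D s.1‖ = |(s.1.1 : ℝ)| ^ (-v) * (1 / ‖D s.1‖) := by ring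
    _ ≤ ((G / 2) ^ (-v) * (t ^ (-v)) ^ k s * |(j : ℝ)| ^ (-v)) * (2 * 2 ^ k s) := by
      rw [← e2]; gcongr
    _ = _ := by rw [mul_pow]; ring

theorem oh_summable_norm (n : ℕ) (v : ℝ) (hv : (n : ℝ) < v) :
    Summable fun Q : Fin n → ℤ => ‖Q‖ ^ (-v) := by
  let L : Submodule ℤ (Fin n → ℝ) := Submodule.span ℤ (Set.range (Pi.basisFun ℝ (Fin n)))
  have hrank : Module.finrank ℤ L = n := by
    rw [Module.finrank_eq_card_basis ((Pi.basisFun ℝ (Fin n)).restrictScalars ℤ)]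
    simp
  have hmem : ∀ Q : Fin n → ℤ, (fun i => (Q i : ℝ)) ∈ L := by
    intro Q
    rw [(Pi.basisFun ℝ (Fin n)).mem_span_iff_repr_mem ℤ]
    intro i
    exact ⟨Q i, by simp⟩
  have h := ZLattice.summable_norm_rpow L (-v) (by rw [hrank]; linarith)
  have hinj : Function.Injective (fun Q : Fin n → ℤ => (⟨fun i => (Q i : ℝ), hmem Q⟩ : L)) := by
    intro Q Q' hQ
    have := congrArg Subtype.val hQ
    ext i
    have := congrFun this i
    simpa using this
  refine (h.comp_injective hinj).congr fun Q => ?_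
  simp only [Function.comp, Submodule.coe_norm]
  congr 1

theorem oh_param_sum {m : ℕ} (A : Fin (m + 1) → ℝ) (x : Fin m → ℝ) (Q : Fin (m + 1) → ℤ) (p : ℤ) :
    (∑ i, paramHyp A x i * Q i) + (p : ℝ) = ((Q (Fin.last m) : ℝ) * A 0 + p) +
      ∑ j : Fin m, ((Q (Fin.last m) : ℝ) * A j.succ + (Q j.castSucc : ℝ)) * x j := by
  rw [Fin.sum_univ_castSucc]
  simp only [paramHyp, Fin.snoc_castSucc, Fin.snoc_last, add_mul, Finset.sum_add_distrib,
    Finset.sum_mul]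
  have h1 : ∀ i, x i * A i.succ * (Q (Fin.last m) : ℝ) = Q (Fin.last m) * A i.succ * x i :=
    fun i => by ring
  have h2 : ∀ i : Fin m, x i * (Q i.castSucc : ℝ) = Q i.castSucc * x i := fun i => by ring
  simp only [h1, h2]
  ring

theorem oh_ae_box {m : ℕ} (hm : 0 < m) (A : Fin (m + 1) → ℝ) (v : ℝ)
    (h : max (omegaCol A) ((m : ℝ≥0∞) + 1) < ENNReal.ofReal v) (R : ℝ) (hR : 0 ≤ R) :
    ∀ᵐ x : Fin m → ℝ, x ∈ Set.Icc (fun _ => -R) (fun _ => R) →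
      {Q : Fin (m + 1) → ℤ | ∃ p : ℤ,
        |(∑ i, paramHyp A x i * Q i) + (p : ℝ)| < (snormZ Q) ^ (-v)}.Finite := by
  obtain ⟨u, hu0, hMu, huv⟩ := ENNReal.lt_iff_exists_real_btwn.mp h
  have hMu : max (omegaCol A) ((m : ℝ≥0∞) + 1) < ENNReal.ofReal u := hMu
  have huv : ENNReal.ofReal u < ENNReal.ofReal v := huv
  have hmu : (m : ℝ) + 1 < u := by
    have h1 := (le_max_right _ _).trans_lt hMu
    have h2 : ((m : ℝ≥0∞) + 1) = ENNReal.ofReal ((m : ℝ) + 1) := by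
      rw [ENNReal.ofReal_add (by positivity) (by positivity)]; simp
    rw [h2] at h1
    exact ((ENNReal.ofReal_lt_ofReal_iff_of_nonneg (by positivity)).mp h1)
  have huv' : u < v := (ENNReal.ofReal_lt_ofReal_iff_of_nonneg hu0).mp huv
  have hm1 : (1 : ℝ) ≤ m := by exact_mod_cast hm
  have hu1 : 1 < u := by linarith
  have hv0 : 0 < v := by linarith
  obtain ⟨c, hc, hsep⟩ := oh_sep A u (by linarith) ((le_max_left _ _).trans_lt hMu)
  have hsum1 := oh_summable_small A u v c hu1 huv' hc hsep
  have hsum2 := oh_summable_norm (m + 1) v (by push_cast; linarith)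
  obtain ⟨K1, hK1, hpair⟩ := oh_pair hm R hR
  obtain ⟨K2, hK2, hlarge⟩ := oh_large hm R hR
  let s1 : {s : ℤ × (Fin (m + 1) → ℤ) // s.1 ≠ 0 ∧
        ‖fun i => (s.1 : ℝ) * A i + (s.2 i : ℝ)‖ < 1 / 2} → Set (Fin m → ℝ) := fun s =>
    {x | x ∈ Set.Icc (fun _ => -R) (fun _ => R) ∧
      |((s.1.1 : ℝ) * A 0 + s.1.2 0) + ∑ j : Fin m, ((s.1.1 : ℝ) * A j.succ + (s.1.2 j.succ : ℝ)) * x j|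
        < |(s.1.1 : ℝ)| ^ (-v)}
  let s2 : (Fin (m + 1) → ℤ) → Set (Fin m → ℝ) := fun Q =>
    {x | x ∈ Set.Icc (fun _ => -R) (fun _ => R) ∧ ∃ p : ℤ,
      (1 / 2 ≤ |(Q (Fin.last m) : ℝ) * A 0 + p| ∨
        ∃ i : Fin m, 1 / 2 ≤ |(Q (Fin.last m) : ℝ) * A i.succ + (Q i.castSucc : ℝ)|) ∧
      |(Q (Fin.last m) : ℝ) * A 0 + p +
        ∑ j : Fin m, ((Q (Fin.last m) : ℝ) * A j.succ + (Q j.castSucc : ℝ)) * x j| < ‖Q‖ ^ (-v)}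
  have hb1 : ∀ s, volume (s1 s) ≤ ENNReal.ofReal
      (K1 * (|(s.1.1 : ℝ)| ^ (-v) / ‖fun i => (s.1.1 : ℝ) * A i + (s.1.2 i : ℝ)‖)) := by
    intro s
    have hq : (0 : ℝ) < |(s.1.1 : ℝ)| := by rw [abs_pos]; exact_mod_cast s.2.1
    have hδ : 0 < ‖fun i => (s.1.1 : ℝ) * A i + (s.1.2 i : ℝ)‖ := by
      refine lt_of_lt_of_le ?_ (hsep s.1.1 s.2.1 s.1.2)
      positivity
    refine hpair _ (fun j : Fin m => (s.1.1 : ℝ) * A j.succ + (s.1.2 j.succ : ℝ)) _ _ hδ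
      (by positivity) ?_
    have h1 : ¬ ∀ i, ‖(s.1.1 : ℝ) * A i + (s.1.2 i : ℝ)‖ <
        ‖fun i => (s.1.1 : ℝ) * A i + (s.1.2 i : ℝ)‖ := by
      intro hh
      exact lt_irrefl _ ((pi_norm_lt_iff hδ).mpr hh)
    push Not at h1
    obtain ⟨i, hi⟩ := h1
    rw [Real.norm_eq_abs] at hi
    revert hi
    refine Fin.cases (fun hi => Or.inl hi) (fun j hi => Or.inr ⟨j, hi⟩) i
  have hb2 : ∀ Q, volume (s2 Q) ≤ ENNReal.ofReal (K2 * ‖Q‖ ^ (-v)) := by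
    intro Q
    by_cases hQ : Q = 0
    · have : s2 Q = ∅ := by
        rw [Set.eq_empty_iff_forall_notMem]
        rintro x ⟨_, p, _, hx⟩
        rw [hQ, norm_zero, Real.zero_rpow (by linarith)] at hx
        exact absurd hx (not_lt.mpr (abs_nonneg _))
      rw [this]; simp
    · have := oh_one_le_norm hQ
      exact hlarge _ (fun j : Fin m => (Q (Fin.last m) : ℝ) * A j.succ + (Q j.castSucc : ℝ)) _
        (by positivity)
  have hae1 := ae_finite_setOfPred_mem (μ := volume) (s := s1)
    (ne_top_of_le_ne_top (hsum1.mul_left K1).tsum_ofReal_ne_top (ENNReal.tsum_le_tsum hb1))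
  have hae2 := ae_finite_setOfPred_mem (μ := volume) (s := s2)
    (ne_top_of_le_ne_top (hsum2.mul_left K2).tsum_ofReal_ne_top (ENNReal.tsum_le_tsum hb2))
  filter_upwards [hae1, hae2] with x hx1 hx2 hxR
  refine ((hx1.image (fun s => (Fin.snoc (fun j : Fin m => s.1.2 j.succ) s.1.1 :
    Fin (m + 1) → ℤ))).union hx2).subset ?_
  rintro Q ⟨p, hp⟩
  rw [oh_param_sum, oh_snorm_eq] at hp
  have hQ0 : Q ≠ 0 := by
    intro hQ
    rw [hQ, norm_zero, Real.zero_rpow (by linarith)] at hp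
    exact absurd hp (not_lt.mpr (abs_nonneg _))
  set q : ℤ := Q (Fin.last m) with hq
  let P : Fin (m + 1) → ℤ := Fin.cons p (fun j : Fin m => Q j.castSucc)
  by_cases hsm : ‖fun i => (q : ℝ) * A i + (P i : ℝ)‖ < 1 / 2
  · left
    have hq0 : q ≠ 0 := by
      intro hq0
      apply hQ0
      rw [pi_norm_lt_iff (by norm_num)] at hsm
      ext i
      refine Fin.lastCases ?_ (fun j => ?_) i
      · exact hq0
      · have h1 := hsm j.succ
        simp only [hq0, Int.cast_zero, zero_mul, zero_add, P, Fin.cons_succ, Real.norm_eq_abs] at h1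
        have h3 : |((Q j.castSucc : ℤ) : ℝ)| < 1 := by linarith
        have h4 : |Q j.castSucc| < 1 := by exact_mod_cast h3
        rw [Int.abs_lt_one_iff] at h4
        exact h4
    refine ⟨⟨(q, P), hq0, hsm⟩, ⟨hxR, ?_⟩, ?_⟩
    · simp only [P, Fin.cons_zero, Fin.cons_succ]
      refine hp.trans_le ?_
      have h1 := norm_le_pi_norm Q (Fin.last m)
      rw [Int.norm_eq_abs] at h1
      exact Real.rpow_le_rpow_of_nonpos (by rw [abs_pos]; exact_mod_cast hq0) h1 (by linarith)
    · simp only [P, Fin.cons_succ]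
      ext i
      refine Fin.lastCases ?_ (fun j => ?_) i
      · simp [hq]
      · simp
  · right
    refine ⟨hxR, p, ?_, hp⟩
    rw [pi_norm_lt_iff (by norm_num)] at hsm
    push Not at hsm
    obtain ⟨i, hi⟩ := hsm
    rw [Real.norm_eq_abs] at hi
    revert hi
    refine Fin.cases (fun hi => Or.inl ?_) (fun j hi => Or.inr ⟨j, ?_⟩) i
    · simpa [P] using hi
    · simpa [P] using hi

theorem oh_ae {m : ℕ} (hm : 0 < m) (A : Fin (m + 1) → ℝ) (v : ℝ)
    (h : max (omegaCol A) ((m : ℝ≥0∞) + 1) < ENNReal.ofReal v) :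
    ∀ᵐ x : Fin m → ℝ, {Q : Fin (m + 1) → ℤ | ∃ p : ℤ,
        |(∑ i, paramHyp A x i * Q i) + (p : ℝ)| < (snormZ Q) ^ (-v)}.Finite := by
  have := ae_all_iff.mpr (fun R : ℕ => oh_ae_box hm A v h R (by positivity))
  filter_upwards [this] with x hx
  obtain ⟨R, hR⟩ := exists_nat_ge ‖x‖
  refine hx R ?_
  constructor <;> intro i
  · have := (norm_le_pi_norm x i).trans hR
    rw [Real.norm_eq_abs, abs_le] at this
    exact this.1
  · have := (norm_le_pi_norm x i).trans hR
    rw [Real.norm_eq_abs, abs_le] at this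
    exact this.2

theorem oh_embedding {m : ℕ} (A : Fin (m + 1) → ℝ) : MeasurableEmbedding (paramHyp A) := by
  apply Continuous.measurableEmbedding
  · refine continuous_pi fun i => ?_
    refine Fin.lastCases ?_ (fun j => ?_) i
    · simp only [paramHyp, Fin.snoc_last]
      fun_prop
    · simp only [paramHyp, Fin.snoc_castSucc]
      fun_prop
  · intro x y hxy
    ext i
    have := congrFun hxy i.castSucc
    simpa [paramHyp] using this

/-- Theorem 0.4, codimension one case: for a hyperplane `𝓛 ⊆ ℝⁿ` (`n = m+1`) parametrized
by `x ↦ (x, (1,x)A)`, the Diophantine exponent of `𝓛` (the essential supremum of `ω` with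
respect to the Lebesgue measure class on `𝓛`) equals `max(ω(A), n)`. -/
theorem omega_hyperplane {m : ℕ} (hm : 0 < m) (A : Fin (m + 1) → ℝ) :
    essSup (fun y => omegaExp y)
        (Measure.map (paramHyp A) (volume : Measure (Fin m → ℝ))) =
      max (omegaCol A) ((m : ℝ≥0∞) + 1) := by
  rw [(oh_embedding A).essSup_map_measure]
  apply le_antisymm
  · refine essSup_le_of_ae_le _ ?_
    have hall : ∀ᵐ x : Fin m → ℝ, ∀ v : ℚ,
        max (omegaCol A) ((m : ℝ≥0∞) + 1) < ENNReal.ofReal (v : ℝ) →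
        {Q : Fin (m + 1) → ℤ | ∃ p : ℤ,
          |(∑ i, paramHyp A x i * Q i) + (p : ℝ)| < (snormZ Q) ^ (-(v : ℝ))}.Finite := by
      rw [ae_all_iff]
      intro v
      by_cases hv : max (omegaCol A) ((m : ℝ≥0∞) + 1) < ENNReal.ofReal (v : ℝ)
      · filter_upwards [oh_ae hm A v hv] with x hx _ using hx
      · exact Filter.Eventually.of_forall fun x h => absurd h hv
    filter_upwards [hall] with x hx
    refine sSup_le ?_
    rintro e ⟨w, rfl, hw, hinf⟩
    by_contra hlt
    obtain ⟨r, hr0, hr1, hr2⟩ := ENNReal.lt_iff_exists_rat_btwn.mp (not_le.mp hlt)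
    have hr2' : ENNReal.ofReal (r : ℝ) < ENNReal.ofReal w := hr2
    have hrw : (r : ℝ) < w := (ENNReal.ofReal_lt_ofReal_iff hw).mp hr2'
    refine hinf ((hx r hr1).subset ?_)
    rintro Q ⟨p, hp⟩
    refine ⟨p, hp.trans_le ?_⟩
    rw [oh_snorm_eq] at hp ⊢
    have hQ0 : Q ≠ 0 := by
      intro hQ
      rw [hQ, norm_zero, Real.zero_rpow (by linarith)] at hp
      exact absurd hp (not_lt.mpr (abs_nonneg _))
    exact Real.rpow_le_rpow_of_exponent_le (oh_one_le_norm hQ0) (by linarith)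
  · have h1 : essSup (fun _ : Fin m → ℝ => max (omegaCol A) ((m : ℝ≥0∞) + 1)) volume ≤
        essSup ((fun y => omegaExp y) ∘ paramHyp A) volume := by
      refine essSup_mono_ae ?_
      refine Filter.Eventually.of_forall fun x => ?_
      refine max_le (oh_ge_col A x) ?_
      have := oh_ge_n (Nat.succ_pos m) (paramHyp A x)
      simpa using this
    rwa [essSup_const'] at h1
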